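/- Let α > −1 and dμ = x_n^α dx. Let w ∈ H¹(B₁⁺, dμ) be a weak solution of −div(x_n^α A ∇w) = div(x_n^α g) in B₁⁺ with the weighted conormal condition lim_{x_n→0⁺} x_n^α ⟨A∇w + g, e_n⟩ = 0 on B₁', where A satisfies λ|ξ|² ≤ ⟨Aξ,ξ⟩ and |A| ≤ 1/λ in B₁⁺. If A and g are of L¹(dμ) Dini mean oscillation in B₁⁺ (so that w ∈ C¹ up to B₁' by the Schauder theory), then the unweighted conormal condition holds pointwise: ⟨A∇w + g, e_n⟩ = 0 at every point of B₁'. -/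

import Mathlib

open MeasureTheory Metric Set
open scoped ENNReal

/-- The upper half unit ball in `ℝ^{n+1}`. -/
def upHalfBall (n : ℕ) : Set (EuclideanSpace ℝ (Fin (n+1))) :=
  ball 0 1 ∩ {x | 0 < x (Fin.last n)}

/-- The thin unit ball in `ℝ^{n+1}`. -/
def thinBall (n : ℕ) : Set (EuclideanSpace ℝ (Fin (n+1))) :=
  ball 0 1 ∩ {x | x (Fin.last n) = 0}

/-- The weighted measure `x_n^α dx` on `ℝ^{n+1}`. -/
noncomputable def muWeight (n : ℕ) (α : ℝ) : Measure (EuclideanSpace ℝ (Fin (n+1))) :=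
  volume.withDensity fun x => ENNReal.ofReal (x (Fin.last n) ^ α)


lemma kap_zero {s : ℝ} (hs : s ≤ 0) : deriv expNegInvGlue s = 0 := by
  apply IsLocalMin.deriv_eq_zero
  refine Filter.Eventually.of_forall fun t => ?_
  rw [expNegInvGlue.zero_of_nonpos hs]
  exact expNegInvGlue.nonneg t

lemma kap_pos {s : ℝ} (hs : 0 < s) : 0 < deriv expNegInvGlue s := by
  have h1 : HasDerivAt (fun x : ℝ => Real.exp (-x⁻¹)) (Real.exp (-s⁻¹) * (-(-(s^2)⁻¹))) s :=
    ((hasDerivAt_inv hs.ne').neg).exp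
  have h2 : expNegInvGlue =ᶠ[nhds s] (fun x : ℝ => Real.exp (-x⁻¹)) := by
    filter_upwards [lt_mem_nhds hs] with t ht
    simp [expNegInvGlue, not_le.mpr ht]
  rw [h2.deriv_eq, h1.deriv]
  have := Real.exp_pos (-s⁻¹)
  have : 0 < (s^2)⁻¹ := by positivity
  rw [neg_neg]; positivity

lemma kap_cont : Continuous (deriv expNegInvGlue) :=
  (expNegInvGlue.contDiff (n := 1)).continuous_deriv le_rfl

lemma grad_phi (n : ℕ) (x₀ x : EuclideanSpace ℝ (Fin (n+1))) (c : ℝ) :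
    gradient (fun x => expNegInvGlue (1 - c * ‖x - x₀‖^2)) x
      = (-(2 * c * deriv expNegInvGlue (1 - c * ‖x - x₀‖^2))) • (x - x₀) := by
  apply HasGradientAt.gradient
  rw [hasGradientAt_iff_hasFDerivAt]
  have h1 : HasFDerivAt (fun x : EuclideanSpace ℝ (Fin (n+1)) => x - x₀)
    (ContinuousLinearMap.id ℝ _) x := (hasFDerivAt_id x).sub_const x₀
  have h2 := ((h1.norm_sq).const_mul c).const_sub 1
  have h3 : HasDerivAt expNegInvGlue (deriv expNegInvGlue (1 - c * ‖x - x₀‖^2))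
      (1 - c * ‖x - x₀‖^2) :=
    ((expNegInvGlue.contDiff (n := 1)).differentiable one_ne_zero _).hasDerivAt
  refine (h3.comp_hasFDerivAt x h2).congr_fderiv ?_
  ext v
  simp
  ring

lemma meas_U (n : ℕ) : MeasurableSet (upHalfBall n) := by
  apply IsOpen.measurableSet
  refine isOpen_ball.inter (isOpen_lt continuous_const (by fun_prop))

lemma open_U (n : ℕ) : IsOpen (upHalfBall n) := by
  refine isOpen_ball.inter (isOpen_lt continuous_const (by fun_prop))

lemma intU (n : ℕ) (α : ℝ) (hα : -1 < α) :
    IntegrableOn (fun y : EuclideanSpace ℝ (Fin (n+1)) => y (Fin.last n) ^ α) (upHalfBall n) := by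
  let f : Fin (n+1) → ℝ → ℝ := fun i => if i = Fin.last n then
    (Ioc (0:ℝ) 1).indicator (fun t => t ^ α) else (Icc (-1:ℝ) 1).indicator (fun _ => 1)
  have hf : ∀ i, Integrable (f i) := by
    intro i
    by_cases h : i = Fin.last n
    · simp only [f, h, if_true]
      rw [integrable_indicator_iff measurableSet_Ioc]
      exact (intervalIntegrable_iff_integrableOn_Ioc_of_le zero_le_one).1
        (intervalIntegral.intervalIntegrable_rpow' hα)
    · simp only [f, h, if_false]
      rw [integrable_indicator_iff measurableSet_Icc]
      simp
  have h1 : Integrable (fun x : Fin (n+1) → ℝ => ∏ i, f i (x i)) :=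
    Integrable.fintype_prod hf
  have h2 : Integrable (fun x : EuclideanSpace ℝ (Fin (n+1)) => ∏ i, f i (x i)) :=
    (PiLp.volume_preserving_ofLp (Fin (n+1))).integrable_comp_of_integrable h1
  refine (h2.integrableOn (s := upHalfBall n)).congr_fun ?_ (meas_U n)
  intro y hy
  have hy1 : ∀ i, |y i| ≤ 1 := fun i => by
    have := PiLp.norm_apply_le y i
    have h := hy.1
    simp at h
    rw [Real.norm_eq_abs] at this
    linarith
  have hy2 : 0 < y (Fin.last n) := hy.2
  simp only []
  rw [Finset.prod_eq_single (Fin.last n)]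
  · have := (abs_le.1 (hy1 (Fin.last n))).2
    simp [f, hy2, this]
  · intro b _ hb
    have := (abs_le.1 (hy1 b))
    simp [f, hb, this.1, this.2]
  · simp

lemma tang_zero (n : ℕ) (α : ℝ) (i : Fin (n+1)) (hi : i ≠ Fin.last n) :
    ∫ y in upHalfBall n, y (Fin.last n) ^ α * (deriv expNegInvGlue (1 - ‖y‖^2) * y i) = 0 := by
  let R : EuclideanSpace ℝ (Fin (n+1)) ≃ₗᵢ[ℝ] EuclideanSpace ℝ (Fin (n+1)) :=
    LinearIsometryEquiv.piLpCongrRight 2 (fun j => if j = i then LinearIsometryEquiv.neg ℝ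
      else LinearIsometryEquiv.refl ℝ ℝ)
  have hRi : ∀ y, R y i = - y i := fun y => by simp [R]
  have hRn : ∀ y, R y (Fin.last n) = y (Fin.last n) := fun y => by simp [R, hi.symm]
  rw [← integral_indicator (meas_U n)]
  set G := (upHalfBall n).indicator (fun y : EuclideanSpace ℝ (Fin (n+1)) => 
    y (Fin.last n) ^ α * (deriv expNegInvGlue (1 - ‖y‖^2) * y i)) with hG
  have h := R.measurePreserving.integral_comp R.toHomeomorph.measurableEmbedding G
  have h' : ∀ y, G (R y) = - G y := by
    intro y
    have : R y ∈ upHalfBall n ↔ y ∈ upHalfBall n := by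
      simp [upHalfBall, hRn]
    by_cases hy : y ∈ upHalfBall n
    · rw [hG, indicator_of_mem (this.2 hy), indicator_of_mem hy, hRn, hRi, R.norm_map]
      ring
    · rw [hG, indicator_of_notMem (mt this.1 hy), indicator_of_notMem hy, neg_zero]
  simp only [h', integral_neg] at h
  linarith

lemma kap_bdd : ∃ K, ∀ (n : ℕ), ∀ y ∈ upHalfBall n, |deriv expNegInvGlue (1 - ‖y‖^2)| ≤ K := by
  obtain ⟨K, hK⟩ := (isCompact_Icc (a := (0:ℝ)) (b := 1)).exists_bound_of_continuousOn
    kap_cont.continuousOn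
  refine ⟨K, fun n y hy => hK _ ?_⟩
  have h := hy.1
  simp at h
  have := norm_nonneg y
  constructor <;> nlinarith

lemma coord_le {n : ℕ} {y : EuclideanSpace ℝ (Fin (n+1))} (hy : y ∈ upHalfBall n) (i) :
    |y i| ≤ 1 := by
  have := PiLp.norm_apply_le y i
  have h := hy.1
  simp at h
  rw [Real.norm_eq_abs] at this
  linarith

lemma int_i (n : ℕ) (α : ℝ) (hα : -1 < α) (i : Fin (n+1)) :
    IntegrableOn (fun y : EuclideanSpace ℝ (Fin (n+1)) =>
      y (Fin.last n) ^ α * (deriv expNegInvGlue (1 - ‖y‖^2) * y i)) (upHalfBall n) := by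
  obtain ⟨K, hK⟩ := kap_bdd
  refine Integrable.mul_bdd (c := K) (intU n α hα) ?_ ?_
  · have := kap_cont
    exact Continuous.aestronglyMeasurable (by fun_prop)
  · refine (ae_restrict_iff' (meas_U n)).2 (Filter.Eventually.of_forall fun y hy => ?_)
    rw [norm_mul]
    have h1 := hK n y hy
    have h2 := coord_le hy i
    calc _ ≤ K * 1 := mul_le_mul h1 h2 (abs_nonneg _) ((abs_nonneg _).trans h1)
      _ = K := mul_one K

lemma normal_pos (n : ℕ) (α : ℝ) (hα : -1 < α) :
    0 < ∫ y in upHalfBall n,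
      y (Fin.last n) ^ α * (deriv expNegInvGlue (1 - ‖y‖^2) * y (Fin.last n)) := by
  have hp : ∀ y ∈ upHalfBall n,
      0 < y (Fin.last n) ^ α * (deriv expNegInvGlue (1 - ‖y‖^2) * y (Fin.last n)) := by
    intro y hy
    have h2 : 0 < y (Fin.last n) := hy.2
    have h := hy.1
    simp at h
    have := norm_nonneg y
    have := kap_pos (s := 1 - ‖y‖^2) (by nlinarith)
    positivity
  rw [setIntegral_pos_iff_support_of_nonneg_ae _ (int_i n α hα _)]
  · have : upHalfBall n ⊆ Function.support (fun y : EuclideanSpace ℝ (Fin (n+1)) =>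
      y (Fin.last n) ^ α * (deriv expNegInvGlue (1 - ‖y‖^2) * y (Fin.last n))) ∩ upHalfBall n :=
      fun y hy => ⟨(hp y hy).ne', hy⟩
    refine lt_of_lt_of_le ?_ (measure_mono this)
    refine (open_U n).measure_pos _ ⟨EuclideanSpace.single (Fin.last n) (1/2), ?_⟩
    simp [upHalfBall]
    norm_num
  · exact (ae_restrict_iff' (meas_U n)).2 (Filter.Eventually.of_forall fun y hy => (hp y hy).le)

lemma scaled (n : ℕ) (α : ℝ) (F : EuclideanSpace ℝ (Fin (n+1)) → Fin (n+1) → ℝ)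
    (hweak : ∀ φ : EuclideanSpace ℝ (Fin (n+1)) → ℝ, ContDiff ℝ (⊤ : ℕ∞) φ →
      HasCompactSupport φ → tsupport φ ⊆ ball (0 : EuclideanSpace ℝ (Fin (n+1))) 1 →
      ∫ x in upHalfBall n, (x (Fin.last n)) ^ α * ∑ i, F x i * gradient φ x i = 0)
    (x₀ : EuclideanSpace ℝ (Fin (n+1))) (hx₀ : x₀ ∈ thinBall n) (r : ℝ) (hr : 0 < r)
    (hr1 : r < 1 - ‖x₀‖) :
    ∫ y in upHalfBall n, y (Fin.last n) ^ α *
      ∑ i, F (x₀ + r • y) i * (deriv expNegInvGlue (1 - ‖y‖^2) * y i) = 0 := by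
  have hx0n : x₀ (Fin.last n) = 0 := hx₀.2
  let φ : EuclideanSpace ℝ (Fin (n+1)) → ℝ :=
    fun x => expNegInvGlue (1 - (r^2)⁻¹ * ‖x - x₀‖^2)
  have hφ1 : ContDiff ℝ (⊤ : ℕ∞) φ := by
    refine expNegInvGlue.contDiff.comp ?_
    exact contDiff_const.sub (contDiff_const.mul ((contDiff_id.sub contDiff_const).norm_sq ℝ))
  have hsup : tsupport φ ⊆ closedBall x₀ r := by
    refine closure_minimal (fun x hx => ?_) isClosed_closedBall
    by_contra hx'
    apply hx
    apply expNegInvGlue.zero_of_nonpos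
    rw [mem_closedBall, dist_eq_norm, not_le] at hx'
    have h1 : r^2 ≤ ‖x - x₀‖^2 := by gcongr
    have h2 : 1 ≤ (r^2)⁻¹ * ‖x - x₀‖^2 := by
      rw [inv_mul_eq_div, one_le_div (by positivity)]; exact h1
    linarith
  have hφ2 : HasCompactSupport φ :=
    (isCompact_closedBall x₀ r).of_isClosed_subset (isClosed_tsupport φ) hsup
  have hφ3 : tsupport φ ⊆ ball 0 1 := by
    refine hsup.trans fun x hx => ?_
    rw [mem_closedBall, dist_eq_norm] at hx
    rw [mem_ball_zero_iff]
    have := norm_le_norm_add_norm_sub' x x₀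
    linarith
  have h0 := hweak φ hφ1 hφ2 hφ3
  simp only [φ, grad_phi] at h0
  rw [← integral_indicator (meas_U n)] at h0 ⊢
  set G := (upHalfBall n).indicator (fun x : EuclideanSpace ℝ (Fin (n+1)) =>
    x (Fin.last n) ^ α * ∑ i, F x i *
      ((-(2 * (r^2)⁻¹ * deriv expNegInvGlue (1 - (r^2)⁻¹ * ‖x - x₀‖^2))) • (x - x₀)) i) with hG
  set H := (upHalfBall n).indicator (fun y : EuclideanSpace ℝ (Fin (n+1)) =>
    y (Fin.last n) ^ α *
      ∑ i, F (x₀ + r • y) i * (deriv expNegInvGlue (1 - ‖y‖^2) * y i)) with hH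
  have key : ∀ y, H y = (-(2 * (r^2)⁻¹ * r * r^α))⁻¹ * G (x₀ + r • y) := by
    intro y
    have hn : (x₀ + r • y) (Fin.last n) = r * y (Fin.last n) := by simp [hx0n]
    have hk : (r^2)⁻¹ * ‖x₀ + r • y - x₀‖^2 = ‖y‖^2 := by
      rw [add_sub_cancel_left, norm_smul, Real.norm_eq_abs, mul_pow, sq_abs]
      field_simp
    by_cases hpos : 0 < y (Fin.last n)
    swap
    · rw [hG, hH, indicator_of_notMem, indicator_of_notMem, mul_zero]
      · intro h; have h' : 0 < (x₀ + r • y) (Fin.last n) := h.2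
        rw [hn] at h'
        exact hpos (pos_of_mul_pos_right h' hr.le)
      · intro h; exact hpos h.2
    by_cases hy : ‖y‖ < 1
    · have m1 : y ∈ upHalfBall n := ⟨by simpa using hy, hpos⟩
      have m2 : x₀ + r • y ∈ upHalfBall n := by
        refine ⟨?_, ?_⟩
        · rw [mem_ball_zero_iff]
          have h1 := norm_add_le x₀ (r • y)
          rw [norm_smul, Real.norm_eq_abs, abs_of_pos hr] at h1
          nlinarith
        · rw [mem_setOf_eq, hn]; positivity
      rw [hG, hH, indicator_of_mem m1, indicator_of_mem m2, hk, hn,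
        Real.mul_rpow hr.le hpos.le, Finset.mul_sum, Finset.mul_sum, Finset.mul_sum]
      refine Finset.sum_congr rfl fun i _ => ?_
      have hra : r ^ α ≠ 0 := (Real.rpow_pos_of_pos hr α).ne'
      simp
      field_simp
    · have hk0 : deriv expNegInvGlue (1 - ‖y‖^2) = 0 := by
        apply kap_zero; nlinarith
      rw [hG, hH, indicator_of_notMem (fun h => hy (by simpa using h.1))]
      simp only [indicator]
      rw [hk, hk0]
      simp
  simp only [key]
  rw [integral_const_mul]
  have h2 := Measure.integral_comp_smul volume (fun z => G (x₀ + z)) r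
  rw [integral_add_left_eq_self, h0, smul_zero] at h2
  rw [h2, mul_zero]

lemma core (n : ℕ) (α : ℝ) (hα : -1 < α) (F : EuclideanSpace ℝ (Fin (n+1)) → Fin (n+1) → ℝ)
    (hF : ContinuousOn F (upHalfBall n ∪ thinBall n))
    (hweak : ∀ φ : EuclideanSpace ℝ (Fin (n+1)) → ℝ, ContDiff ℝ (⊤ : ℕ∞) φ →
      HasCompactSupport φ → tsupport φ ⊆ ball (0 : EuclideanSpace ℝ (Fin (n+1))) 1 →
      ∫ x in upHalfBall n, (x (Fin.last n)) ^ α * ∑ i, F x i * gradient φ x i = 0)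
    (x₀ : EuclideanSpace ℝ (Fin (n+1))) (hx₀ : x₀ ∈ thinBall n) :
    F x₀ (Fin.last n) = 0 := by
  have hx0n : x₀ (Fin.last n) = 0 := hx₀.2
  have hx01 : ‖x₀‖ < 1 := by simpa using hx₀.1
  obtain ⟨K, hK⟩ := kap_bdd
  have hmem : ∀ r : ℝ, 0 < r → r < 1 - ‖x₀‖ → ∀ y ∈ upHalfBall n, x₀ + r • y ∈ upHalfBall n := by
    intro r hr hr1 y hy
    have hn : (x₀ + r • y) (Fin.last n) = r * y (Fin.last n) := by simp [hx0n]
    have hy1 : ‖y‖ < 1 := by simpa using hy.1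
    have hpos : 0 < y (Fin.last n) := hy.2
    refine ⟨?_, ?_⟩
    · rw [mem_ball_zero_iff]
      have h1 := norm_add_le x₀ (r • y)
      rw [norm_smul, Real.norm_eq_abs, abs_of_pos hr] at h1
      nlinarith
    · rw [mem_setOf_eq, hn]; positivity
  have hFx : ContinuousWithinAt F (upHalfBall n ∪ thinBall n) x₀ := hF x₀ (Or.inr hx₀)
  obtain ⟨δ, hδ, hFδ⟩ := Metric.continuousWithinAt_iff.1 hFx 1 one_pos
  have hsmall : ∀ᶠ r : ℝ in nhdsWithin 0 (Ioi 0), 0 < r ∧ r < 1 - ‖x₀‖ ∧ r < δ := by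
    filter_upwards [self_mem_nhdsWithin,
      mem_nhdsWithin_of_mem_nhds (Iio_mem_nhds (show (0:ℝ) < 1 - ‖x₀‖ by linarith)),
      mem_nhdsWithin_of_mem_nhds (Iio_mem_nhds hδ)] with r h1 h2 h3
    exact ⟨h1, h2, h3⟩
  let C : ℝ := ‖F x₀‖ + 1
  have hlim : Filter.Tendsto (fun r : ℝ => ∫ y in upHalfBall n, y (Fin.last n) ^ α *
      ∑ i, F (x₀ + r • y) i * (deriv expNegInvGlue (1 - ‖y‖^2) * y i)) (nhdsWithin 0 (Ioi 0))
      (nhds (∫ y in upHalfBall n, y (Fin.last n) ^ α *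
      ∑ i, F x₀ i * (deriv expNegInvGlue (1 - ‖y‖^2) * y i))) := by
    refine tendsto_integral_filter_of_dominated_convergence
      (fun y => y (Fin.last n) ^ α * ((n+1) * (C * K))) ?_ ?_ ?_ ?_
    · filter_upwards [hsmall] with r hr
      refine (intU n α hα).aestronglyMeasurable.mul ?_
      refine ContinuousOn.aestronglyMeasurable ?_ (meas_U n)
      refine continuousOn_finset_sum _ fun i _ => ContinuousOn.mul ?_ ?_
      · have h1 : ContinuousOn (fun x => F x i) (upHalfBall n ∪ thinBall n) :=
          continuousOn_pi.1 hF i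
        refine h1.comp (f := fun y => x₀ + r • y) (by fun_prop)
          fun y hy => Or.inl (hmem r hr.1 hr.2.1 y hy)
      · have := kap_cont
        exact Continuous.continuousOn (by fun_prop)
    · filter_upwards [hsmall] with r hr
      refine (ae_restrict_iff' (meas_U n)).2 (Filter.Eventually.of_forall fun y hy => ?_)
      have hpos : 0 < y (Fin.last n) := hy.2
      have hy1 : ‖y‖ < 1 := by simpa using hy.1
      rw [norm_mul, Real.norm_of_nonneg (Real.rpow_pos_of_pos hpos α).le]
      refine mul_le_mul_of_nonneg_left ?_ (Real.rpow_pos_of_pos hpos α).le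
      refine (norm_sum_le _ _).trans ?_
      have hb : ∀ i ∈ Finset.univ, ‖F (x₀ + r • y) i * (deriv expNegInvGlue (1 - ‖y‖^2) * y i)‖
          ≤ C * K := by
        intro i _
        rw [norm_mul, norm_mul]
        have h1 := hFδ (Or.inl (hmem r hr.1 hr.2.1 y hy)) (by
          rw [dist_eq_norm, add_sub_cancel_left, norm_smul, Real.norm_eq_abs, abs_of_pos hr.1]
          nlinarith [hr.1, hr.2.2, norm_nonneg y])
        rw [dist_eq_norm] at h1
        have h2 := norm_le_norm_add_norm_sub' (F (x₀ + r • y)) (F x₀)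
        have h3 := norm_le_pi_norm (F (x₀ + r • y)) i
        have h4 : ‖F (x₀ + r • y) i‖ ≤ C := by simp only [C]; linarith
        have h5 := hK n y hy
        have h6 := coord_le hy i
        rw [← Real.norm_eq_abs] at h5 h6
        have hK0 := (norm_nonneg _).trans h5
        refine mul_le_mul h4 ?_ (by positivity) ((norm_nonneg _).trans h4)
        calc _ ≤ K * 1 := mul_le_mul h5 h6 (norm_nonneg _) hK0
          _ = K := mul_one K
      refine (Finset.sum_le_sum hb).trans ?_
      simp
    · exact (intU n α hα).mul_const _
    · refine (ae_restrict_iff' (meas_U n)).2 (Filter.Eventually.of_forall fun y hy => ?_)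
      refine Filter.Tendsto.const_mul _ (tendsto_finsetSum _ fun i _ =>
        Filter.Tendsto.mul_const _ ?_)
      have h1 : Filter.Tendsto (fun r : ℝ => x₀ + r • y) (nhdsWithin 0 (Ioi 0))
          (nhdsWithin x₀ (upHalfBall n ∪ thinBall n)) := by
        refine tendsto_nhdsWithin_iff.2 ⟨?_, ?_⟩
        · have : Continuous (fun r : ℝ => x₀ + r • y) := by fun_prop
          have h := this.tendsto 0
          simp only [zero_smul, add_zero] at h
          exact h.mono_left nhdsWithin_le_nhds
        · filter_upwards [hsmall] with r hr
          exact Or.inl (hmem r hr.1 hr.2.1 y hy)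
      exact (tendsto_pi_nhds.1 (hFx.tendsto.comp h1)) i
  have hz : (fun r : ℝ => ∫ y in upHalfBall n, y (Fin.last n) ^ α *
      ∑ i, F (x₀ + r • y) i * (deriv expNegInvGlue (1 - ‖y‖^2) * y i))
      =ᶠ[nhdsWithin 0 (Ioi 0)] fun _ => 0 := by
    filter_upwards [hsmall] with r hr
    exact scaled n α F hweak x₀ hx₀ r hr.1 hr.2.1
  have h0 := tendsto_nhds_unique (hlim.congr' hz) tendsto_const_nhds
  have hsum : ∀ y : EuclideanSpace ℝ (Fin (n+1)), y (Fin.last n) ^ α *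
      ∑ i, F x₀ i * (deriv expNegInvGlue (1 - ‖y‖^2) * y i) =
      ∑ i, F x₀ i * (y (Fin.last n) ^ α * (deriv expNegInvGlue (1 - ‖y‖^2) * y i)) := by
    intro y
    rw [Finset.mul_sum]
    exact Finset.sum_congr rfl fun i _ => by ring
  simp only [hsum] at h0
  rw [integral_finset_sum _ fun i _ => (int_i n α hα i).const_mul _] at h0
  simp only [integral_const_mul] at h0
  rw [Finset.sum_eq_single (Fin.last n)
    (fun i _ hi => by rw [tang_zero n α i hi, mul_zero]) (by simp)] at h0
  exact (mul_eq_zero.1 h0).resolve_right (normal_pos n α hα).ne'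

/-- Let `α > −1`, `dμ = x_n^α dx`, and let `w ∈ H¹(B₁⁺, dμ)` be a weak
solution of `−div(x_n^α A ∇w) = div(x_n^α g)` in `B₁⁺` with the weighted conormal
condition on `B₁'`, for a uniformly elliptic `A`. If `A` and `g` are of `L¹(dμ)` DMO in
`B₁⁺` (so that `w ∈ C¹` up to `B₁'`), then the unweighted conormal condition
`⟨A∇w + g, e_n⟩ = 0` holds at every point of `B₁'`. -/
theorem conormal_condition_unweighted (n : ℕ) (α lam : ℝ) (hα : -1 < α) (hlam : 0 < lam)
    (A : EuclideanSpace ℝ (Fin (n+1)) → Fin (n+1) → Fin (n+1) → ℝ)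
    (g : EuclideanSpace ℝ (Fin (n+1)) → EuclideanSpace ℝ (Fin (n+1)))
    (hell : ∀ x ∈ upHalfBall n, ∀ ξ : EuclideanSpace ℝ (Fin (n+1)),
      lam * ‖ξ‖^2 ≤ ∑ i, ∑ j, A x i j * ξ i * ξ j)
    (hbd : ∀ x ∈ upHalfBall n, ∀ i j, |A x i j| ≤ 1/lam)
    (w : EuclideanSpace ℝ (Fin (n+1)) → ℝ)
    (w' : EuclideanSpace ℝ (Fin (n+1)) → EuclideanSpace ℝ (Fin (n+1)))
    (hgrad : ∀ x ∈ upHalfBall n, HasGradientAt w (w' x) x)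
    (hw'cont : ContinuousOn w' (upHalfBall n ∪ thinBall n))
    (hAcont : ContinuousOn A (upHalfBall n ∪ thinBall n))
    (hgcont : ContinuousOn g (upHalfBall n ∪ thinBall n))
    (hweak : ∀ φ : EuclideanSpace ℝ (Fin (n+1)) → ℝ, ContDiff ℝ (⊤ : ℕ∞) φ →
      HasCompactSupport φ → tsupport φ ⊆ ball (0 : EuclideanSpace ℝ (Fin (n+1))) 1 →
      ∫ x in upHalfBall n, (x (Fin.last n)) ^ α *
        ∑ i, ((∑ j, A x i j * w' x j) + g x i) * gradient φ x i = 0)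
    (ηA ηg : ℝ → ℝ)
    (hηA : ∀ r : ℝ, ηA r =
      ⨆ x₀ : upHalfBall n,
        ⨍ x in upHalfBall n ∩ ball (x₀ : EuclideanSpace ℝ (Fin (n+1))) r,
          ‖A x - ⨍ y in upHalfBall n ∩ ball (x₀ : EuclideanSpace ℝ (Fin (n+1))) r,
            A y ∂(muWeight n α)‖ ∂(muWeight n α))
    (hηg : ∀ r : ℝ, ηg r =
      ⨆ x₀ : upHalfBall n,
        ⨍ x in upHalfBall n ∩ ball (x₀ : EuclideanSpace ℝ (Fin (n+1))) r,
          ‖g x - ⨍ y in upHalfBall n ∩ ball (x₀ : EuclideanSpace ℝ (Fin (n+1))) r,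
            g y ∂(muWeight n α)‖ ∂(muWeight n α))
    (hDMOA : IntegrableOn (fun r => ηA r / r) (Ioo (0:ℝ) 1))
    (hDMOg : IntegrableOn (fun r => ηg r / r) (Ioo (0:ℝ) 1)) :
    ∀ x ∈ thinBall n,
      (∑ j, A x (Fin.last n) j * w' x j) + g x (Fin.last n) = 0 := by
  intro x hx
  refine core n α hα (fun x i => (∑ j, A x i j * w' x j) + g x i) ?_ hweak x hx
  refine continuousOn_pi.2 fun i => ContinuousOn.add (continuousOn_finset_sum _ fun j _ => ?_) ?_
  · refine ContinuousOn.mul (continuousOn_pi.1 (continuousOn_pi.1 hAcont i) j) ?_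
    exact (PiLp.continuous_apply 2 _ j).comp_continuousOn hw'cont
  · exact (PiLp.continuous_apply 2 _ i).comp_continuousOn hgcont
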